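/- There is a universal constant C > 0 such that for every n ≥ 1 and every total Boolean function f : {0,1}^n → {0,1}, λ(f) ≤ C · adeg(f). -/

import Mathlib

noncomputable def specNorm {I : Type*} [Fintype I] [DecidableEq I] (A : Matrix I I ℝ) : ℝ :=
  ‖Matrix.toEuclideanCLM (𝕜 := ℝ) A‖

/-- Adjacency matrix of the sensitivity graph of `f`. -/
def sensAdj {I : Type*} [Fintype I] [DecidableEq I] (f : (I → Bool) → Bool) :
    Matrix (I → Bool) (I → Bool) ℝ :=
  Matrix.of fun x y => if hammingDist x y = 1 ∧ f x ≠ f y then (1 : ℝ) else 0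

/-- Spectral sensitivity `λ(f)`: the ℓ2→ℓ2 operator norm of the adjacency matrix of the
sensitivity graph of `f`. -/
noncomputable def specSens {I : Type*} [Fintype I] [DecidableEq I] (f : (I → Bool) → Bool) : ℝ :=
  specNorm (sensAdj f)

/-- Approximate degree of a Boolean function: minimum total degree of a real polynomial
approximating it pointwise to error 1/3 on the Boolean cube. -/
noncomputable def adegB {n : ℕ} (f : (Fin n → Bool) → Bool) : ℕ :=
  sInf {d | ∃ p : MvPolynomial (Fin n) ℝ, p.totalDegree = d ∧
    ∀ x : Fin n → Bool,
      |MvPolynomial.eval (fun i => if x i then (1 : ℝ) else 0) p - (if f x then 1 else 0)| ≤ 1/3}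

section Walsh

variable {I : Type*} [DecidableEq I]

/-- Negate the `i`-th bit of a point of the Boolean cube. -/
def flipBit (x : I → Bool) (i : I) : I → Bool :=
  Function.update x i (!x i)

lemma flipBit_involutive (i : I) : Function.Involutive fun x : I → Bool => flipBit x i := by
  intro x
  ext j
  by_cases h : j = i
  · subst h; simp [flipBit]
  · simp [flipBit, h]

lemma flipBit_flipBit (x : I → Bool) (i : I) : flipBit (flipBit x i) i = x :=
  flipBit_involutive i x

lemma flipBit_self (x : I → Bool) (i : I) : flipBit x i i = !x i := by
  simp [flipBit]

lemma flipBit_of_ne (x : I → Bool) {i j : I} (h : j ≠ i) : flipBit x i j = x j := by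
  simp [flipBit, h]

/-- The Walsh character of the Boolean cube indexed by `S`. -/
def walsh (S : Finset I) (x : I → Bool) : ℝ :=
  ∏ i ∈ S, if x i then -1 else 1

lemma walsh_flipBit (S : Finset I) (x : I → Bool) (i : I) :
    walsh S (flipBit x i) = if i ∈ S then -walsh S x else walsh S x := by
  unfold walsh
  split_ifs with h
  · rw [← Finset.mul_prod_erase S _ h, ← Finset.mul_prod_erase S _ h, ← neg_mul]
    congr 1
    · rw [flipBit_self]
      cases x i <;> simp
    · refine Finset.prod_congr rfl fun j hj => ?_
      rw [flipBit_of_ne _ (Finset.ne_of_mem_erase hj)]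
  · refine Finset.prod_congr rfl fun j hj => ?_
    rw [flipBit_of_ne _ (by rintro rfl; exact h hj)]

lemma flipBit_injective (x : I → Bool) : Function.Injective (flipBit x) := by
  intro i j h
  by_contra e
  have := congrFun h i
  rw [flipBit_self, flipBit_of_ne _ e] at this
  simp at this

lemma walsh_mul_self {J : Type*} (S : Finset J) (x : J → Bool) : walsh S x * walsh S x = 1 := by
  unfold walsh
  rw [← Finset.prod_mul_distrib]
  exact Finset.prod_eq_one fun i _ => by cases x i <;> simp

variable [Fintype I]

lemma sum_flipBit (F : (I → Bool) → ℝ) (i : I) : ∑ x, F (flipBit x i) = ∑ x, F x :=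
  Equiv.sum_comp (flipBit_involutive i).toPerm F

lemma sum_eq_zero_of_flipBit_neg (F : (I → Bool) → ℝ) (i : I)
    (h : ∀ x, F (flipBit x i) = -F x) : ∑ x, F x = 0 := by
  have h1 := sum_flipBit F i
  simp only [h, Finset.sum_neg_distrib] at h1
  linarith

lemma sum_walsh_mul_mul_walsh_eq_zero {S T : Finset I} {m : (I → Bool) → ℝ} {i : I}
    (hi : i ∈ symmDiff S T) (hm : ∀ x, m (flipBit x i) = m x) :
    ∑ x, walsh S x * m x * walsh T x = 0 := by
  refine sum_eq_zero_of_flipBit_neg _ i fun x => ?_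
  rw [hm, walsh_flipBit, walsh_flipBit]
  rcases Finset.mem_symmDiff.1 hi with ⟨h1, h2⟩ | ⟨h1, h2⟩ <;> simp [h1, h2]

lemma sum_walsh_mul_walsh (S T : Finset I) :
    ∑ x, walsh S x * walsh T x = if S = T then (2 : ℝ) ^ Fintype.card I else 0 := by
  split_ifs with h
  · subst h
    simp [walsh_mul_self]
  · obtain ⟨i, hi⟩ : (symmDiff S T).Nonempty :=
      Finset.nonempty_iff_ne_empty.2 fun e => h (symmDiff_eq_bot.1 e)
    simpa using sum_walsh_mul_mul_walsh_eq_zero (m := fun _ => 1) hi (fun _ => rfl)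

lemma sum_walsh_apply_mul_walsh_apply (x y : I → Bool) :
    ∑ S : Finset I, walsh S x * walsh S y = if x = y then (2 : ℝ) ^ Fintype.card I else 0 := by
  have h : ∑ S : Finset I, walsh S x * walsh S y =
      ∏ i, (1 + (if x i then (-1 : ℝ) else 1) * (if y i then -1 else 1)) := by
    rw [Finset.prod_one_add, Finset.powerset_univ]
    exact Finset.sum_congr rfl fun S _ => Finset.prod_mul_distrib.symm
  rw [h]
  split_ifs with hxy
  · subst hxy
    rw [← Finset.card_univ]
    refine Finset.prod_eq_pow_card fun i _ => ?_
    cases x i <;> norm_num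
  · obtain ⟨i, hi⟩ := Function.ne_iff.1 hxy
    refine Finset.prod_eq_zero (Finset.mem_univ i) ?_
    revert hi
    cases x i <;> cases y i <;> simp

/-- The function on the cube with Walsh coefficients `a`. -/
def walshSum (a : Finset I → ℝ) (x : I → Bool) : ℝ :=
  ∑ S, a S * walsh S x

lemma exists_eq_walshSum (u : (I → Bool) → ℝ) : ∃ a, u = walshSum a := by
  refine ⟨fun S => ((2 : ℝ) ^ Fintype.card I)⁻¹ * ∑ y, u y * walsh S y, ?_⟩
  ext x
  have h : ∑ S, (∑ y, u y * walsh S y) * walsh S x = (2 : ℝ) ^ Fintype.card I * u x := by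
    simp_rw [Finset.sum_mul]
    rw [Finset.sum_comm]
    simp_rw [mul_assoc, ← Finset.mul_sum, sum_walsh_apply_mul_walsh_apply]
    simp [mul_comm]
  simp only [walshSum, mul_assoc]
  rw [← Finset.mul_sum, h, inv_mul_cancel_left₀ (by positivity)]

lemma sum_walshSum_mul_mul_walshSum (a b : Finset I → ℝ) (P : (I → Bool) → ℝ) :
    ∑ x, walshSum a x * P x * walshSum b x =
      ∑ S, ∑ T, a S * b T * ∑ x, walsh S x * P x * walsh T x := by
  simp_rw [walshSum, Finset.sum_mul, Finset.mul_sum]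
  rw [Finset.sum_comm]
  refine Finset.sum_congr rfl fun S _ => ?_
  rw [Finset.sum_comm]
  refine Finset.sum_congr rfl fun T _ => Finset.sum_congr rfl fun x _ => ?_
  ring

lemma sum_walshSum_sq (a : Finset I → ℝ) :
    ∑ x, walshSum a x ^ 2 = 2 ^ Fintype.card I * ∑ S, a S ^ 2 := by
  have h := sum_walshSum_mul_mul_walshSum a a fun _ => 1
  simp only [mul_one, sum_walsh_mul_walsh, mul_ite, mul_zero, Finset.sum_ite_eq,
    Finset.mem_univ, if_true] at h
  simp only [pow_two (walshSum a _), h, Finset.mul_sum]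
  exact Finset.sum_congr rfl fun S _ => by ring

lemma sum_walsh_flipBit (S : Finset I) (x : I → Bool) :
    ∑ i, walsh S (flipBit x i) = (Fintype.card I - 2 * S.card : ℝ) * walsh S x := by
  have h : ∀ i, walsh S (flipBit x i) = walsh S x - if i ∈ S then 2 * walsh S x else 0 := by
    intro i
    rw [walsh_flipBit]
    split_ifs <;> ring
  simp_rw [h, Finset.sum_sub_distrib]
  simp
  ring

lemma sum_walshSum_flipBit (a : Finset I → ℝ) (x : I → Bool) :
    ∑ i, walshSum a (flipBit x i) =
      walshSum (fun S => (Fintype.card I - 2 * S.card : ℝ) * a S) x := by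
  unfold walshSum
  rw [Finset.sum_comm]
  refine Finset.sum_congr rfl fun S _ => ?_
  rw [← Finset.mul_sum, sum_walsh_flipBit]
  ring

/-- The form of the commutator of multiplication by `P` with the adjacency operator of the cube
acts on Walsh coefficients as a Schur multiplier by differences of levels. -/
lemma sum_commutator_walshSum (a b : Finset I → ℝ) (P : (I → Bool) → ℝ) :
    ∑ x, ∑ i, walshSum a x * (P x - P (flipBit x i)) * walshSum b (flipBit x i) =
      2 * ∑ S, ∑ T, ((S.card : ℝ) - T.card) *
        (a S * b T * ∑ x, walsh S x * P x * walsh T x) := by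
  have h1 : ∑ x, ∑ i, walshSum a x * P x * walshSum b (flipBit x i) =
      ∑ S, ∑ T, a S * ((Fintype.card I - 2 * T.card : ℝ) * b T) *
        ∑ x, walsh S x * P x * walsh T x := by
    rw [← sum_walshSum_mul_mul_walshSum]
    simp_rw [← sum_walshSum_flipBit, Finset.mul_sum]
  have h2 : ∑ x, ∑ i, walshSum a x * P (flipBit x i) * walshSum b (flipBit x i) =
      ∑ S, ∑ T, ((Fintype.card I - 2 * S.card : ℝ) * a S) * b T *
        ∑ x, walsh S x * P x * walsh T x := by
    rw [← sum_walshSum_mul_mul_walshSum]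
    simp_rw [← sum_walshSum_flipBit, Finset.sum_mul]
    rw [Finset.sum_comm, Finset.sum_comm (s := Finset.univ (α := I → Bool))]
    refine Finset.sum_congr rfl fun i _ => (sum_flipBit _ i).symm.trans ?_
    simp only [flipBit_flipBit]
  have h3 := congrArg₂ (· - ·) h1 h2
  simp only [← Finset.sum_sub_distrib, ← sub_mul, ← mul_sub] at h3
  rw [h3, Finset.mul_sum]
  refine Finset.sum_congr rfl fun S _ => ?_
  rw [Finset.mul_sum]
  exact Finset.sum_congr rfl fun T _ => by ring

lemma abs_sum_mul_mul_le {P : (I → Bool) → ℝ} {M : ℝ} (hP : ∀ x, |P x| ≤ M)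
    (u w : (I → Bool) → ℝ) :
    |∑ x, u x * P x * w x| ≤ M / 2 * (∑ x, u x ^ 2 + ∑ x, w x ^ 2) := by
  rw [← Finset.sum_add_distrib, Finset.mul_sum]
  refine (Finset.abs_sum_le_sum_abs _ _).trans (Finset.sum_le_sum fun x _ => ?_)
  have h : |u x * P x * w x| = |P x| * (|u x| * |w x|) := by
    rw [abs_mul, abs_mul]; ring
  have h2 : |u x| * |w x| ≤ (u x ^ 2 + w x ^ 2) / 2 := by
    nlinarith [sq_nonneg (|u x| - |w x|), sq_abs (u x), sq_abs (w x)]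
  calc |u x * P x * w x| = |P x| * (|u x| * |w x|) := h
    _ ≤ M * ((u x ^ 2 + w x ^ 2) / 2) :=
      mul_le_mul (hP x) h2 (by positivity) ((abs_nonneg _).trans (hP x))
    _ = _ := by ring

/-- The number of integers below `N` in the intersection of two windows of length `2 * d` offset by
`d` is affine in the difference of the positions of the windows, as long as this difference is at
most `d`. -/
lemma sum_window_mul_window {j k d N : ℕ} (h1 : j ≤ k + d) (h2 : k ≤ j + d) (h3 : j + 2 * d ≤ N) :
    ∑ r ∈ Finset.range N, (if r ∈ Finset.Ico j (j + 2 * d) then (1 : ℝ) else 0) *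
      (if r ∈ Finset.Ico (k + d) (k + 3 * d) then 1 else 0) = (j : ℝ) - k + d := by
  have h : ∀ r ∈ Finset.range N, (if r ∈ Finset.Ico j (j + 2 * d) then (1 : ℝ) else 0) *
      (if r ∈ Finset.Ico (k + d) (k + 3 * d) then 1 else 0) =
      if r ∈ Finset.Ico (k + d) (j + 2 * d) then 1 else 0 := by
    intro r _
    simp only [Finset.mem_Ico]
    split_ifs <;> first | (exfalso; omega) | norm_num
  rw [Finset.sum_congr rfl h, Finset.sum_ite_mem,
    Finset.inter_eq_right.2 (fun r hr => by simp at hr ⊢; omega), Finset.sum_const,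
    Nat.card_Ico, nsmul_eq_mul, mul_one, Nat.cast_sub (by omega)]
  push_cast
  ring

lemma sum_window_le (N c l : ℕ) :
    ∑ r ∈ Finset.range N, (if r ∈ Finset.Ico c (c + l) then (1 : ℝ) else 0) ≤ l := by
  rw [Finset.sum_ite_mem, Finset.sum_const, nsmul_eq_mul, mul_one]
  exact_mod_cast (Finset.card_le_card Finset.inter_subset_right).trans (by simp)

lemma sum_sum_walshSum_window_sq_le (a : Finset I → ℝ) (c : Finset I → ℕ) (N l : ℕ) :
    ∑ r ∈ Finset.range N, ∑ x,
      walshSum (fun S => (if r ∈ Finset.Ico (c S) (c S + l) then 1 else 0) * a S) x ^ 2 ≤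
      l * ∑ x, walshSum a x ^ 2 := by
  simp_rw [sum_walshSum_sq]
  rw [← Finset.mul_sum, mul_left_comm]
  refine mul_le_mul_of_nonneg_left ?_ (by positivity)
  rw [Finset.sum_comm, Finset.mul_sum]
  refine Finset.sum_le_sum fun S _ => ?_
  simp_rw [mul_pow]
  rw [← Finset.sum_mul]
  refine mul_le_mul_of_nonneg_right ?_ (sq_nonneg _)
  refine le_trans (le_of_eq (Finset.sum_congr rfl fun r _ => ?_)) (sum_window_le N (c S) l)
  split_ifs <;> norm_num

/-- A Bernstein-type inequality: the commutator of a bounded function of degree `d` with the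
adjacency operator of the cube has norm `O(d)`. -/
lemma sum_commutator_le {P : (I → Bool) → ℝ} {M : ℝ} {d : ℕ} (hP : ∀ x, |P x| ≤ M)
    (hd : ∀ S T : Finset I, d < (symmDiff S T).card → ∑ x, walsh S x * P x * walsh T x = 0)
    (u w : (I → Bool) → ℝ) :
    ∑ x, ∑ i, u x * (P x - P (flipBit x i)) * w (flipBit x i) ≤
      3 * M * d * (∑ x, u x ^ 2 + ∑ x, w x ^ 2) := by
  obtain ⟨a, rfl⟩ := exists_eq_walshSum u
  obtain ⟨b, rfl⟩ := exists_eq_walshSum w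
  set N := Fintype.card I + 2 * d with hN
  set ar : ℕ → Finset I → ℝ := fun r S =>
    (if r ∈ Finset.Ico S.card (S.card + 2 * d) then 1 else 0) * a S with har
  set br : ℕ → Finset I → ℝ := fun r T =>
    (if r ∈ Finset.Ico (T.card + d) (T.card + 3 * d) then 1 else 0) * b T with hbr
  have key : ∑ S, ∑ T, ((S.card : ℝ) - T.card) *
        (a S * b T * ∑ x, walsh S x * P x * walsh T x) =
      ∑ r ∈ Finset.range N, ∑ x, walshSum (ar r) x * P x * walshSum (br r) x -
        d * ∑ x, walshSum a x * P x * walshSum b x := by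
    simp_rw [sum_walshSum_mul_mul_walshSum]
    rw [Finset.sum_comm (s := Finset.range N), Finset.mul_sum, ← Finset.sum_sub_distrib]
    refine Finset.sum_congr rfl fun S _ => ?_
    rw [Finset.sum_comm (s := Finset.range N), Finset.mul_sum, ← Finset.sum_sub_distrib]
    refine Finset.sum_congr rfl fun T _ => ?_
    by_cases hST : d < (symmDiff S T).card
    · simp [hd S T hST]
    · have hs : (S \ T).card ≤ (symmDiff S T).card :=
        Finset.card_le_card fun i hi => Finset.mem_symmDiff.2 (Or.inl (by simpa using hi))
      have ht : (T \ S).card ≤ (symmDiff S T).card :=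
        Finset.card_le_card fun i hi => Finset.mem_symmDiff.2 (Or.inr (by simpa using hi))
      have hs' := Finset.le_card_sdiff T S
      have ht' := Finset.le_card_sdiff S T
      have hw := sum_window_mul_window (j := S.card) (k := T.card) (d := d) (N := N)
        (by omega) (by omega) (by have := Finset.card_le_univ S; omega)
      have : ∑ r ∈ Finset.range N, ar r S * br r T * ∑ x, walsh S x * P x * walsh T x =
          ((S.card : ℝ) - T.card + d) * (a S * b T * ∑ x, walsh S x * P x * walsh T x) := by
        rw [← hw, Finset.sum_mul]
        exact Finset.sum_congr rfl fun r _ => by simp only [har, hbr]; ring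
      rw [this]
      ring
  rw [sum_commutator_walshSum, key]
  have hM : 0 ≤ M := (abs_nonneg _).trans (hP fun _ => false)
  have hA := sum_sum_walshSum_window_sq_le a (fun S => S.card) N (2 * d)
  have hB := sum_sum_walshSum_window_sq_le b (fun S => S.card + d) N (2 * d)
  simp only [show ∀ T : Finset I, T.card + d + 2 * d = T.card + 3 * d from fun T => by ring] at hB
  have h1 : ∑ r ∈ Finset.range N, ∑ x, walshSum (ar r) x * P x * walshSum (br r) x ≤
      M / 2 * ∑ r ∈ Finset.range N,
        (∑ x, walshSum (ar r) x ^ 2 + ∑ x, walshSum (br r) x ^ 2) := by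
    rw [Finset.mul_sum]
    exact Finset.sum_le_sum fun r _ => (le_abs_self _).trans (abs_sum_mul_mul_le hP _ _)
  rw [Finset.sum_add_distrib] at h1
  have h2 := h1.trans (mul_le_mul_of_nonneg_left (add_le_add hA hB) (by positivity))
  have h3 := mul_le_mul_of_nonneg_left ((neg_le_abs _).trans
    (abs_sum_mul_mul_le hP (walshSum a) (walshSum b))) (Nat.cast_nonneg (α := ℝ) d)
  push_cast at h2
  linarith

lemma hammingDist_eq_one_iff (x y : I → Bool) :
    hammingDist x y = 1 ↔ ∃ i, flipBit x i = y := by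
  unfold hammingDist
  rw [Finset.card_eq_one]
  refine exists_congr fun i => ?_
  constructor
  · intro h
    ext j
    have hj := Finset.ext_iff.1 h j
    simp only [Finset.mem_filter, Finset.mem_univ, true_and, Finset.mem_singleton] at hj
    by_cases e : j = i
    · subst e
      rw [flipBit_self]
      have := hj.2 rfl
      revert this
      cases x j <;> cases y j <;> simp
    · rw [flipBit_of_ne _ e]
      by_contra hne
      exact e (hj.1 hne)
  · rintro rfl
    ext j
    by_cases e : j = i
    · subst e
      simp [flipBit_self]
    · simp [flipBit_of_ne _ e, e]

lemma sum_hammingDist_eq_one (x : I → Bool) (F : (I → Bool) → ℝ) :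
    ∑ y, (if hammingDist x y = 1 then F y else 0) = ∑ i, F (flipBit x i) := by
  rw [← Finset.sum_filter, ← Finset.sum_image (fun i _ j _ h => flipBit_injective x h)]
  refine Finset.sum_congr ?_ fun _ _ => rfl
  ext y
  simp [hammingDist_eq_one_iff]

lemma sensAdj_comm (f : (I → Bool) → Bool) (x y : I → Bool) :
    sensAdj f x y = sensAdj f y x := by
  simp only [sensAdj, Matrix.of_apply, hammingDist_comm x y, ne_comm (a := f x)]

lemma sensAdj_nonneg (f : (I → Bool) → Bool) (x y : I → Bool) : 0 ≤ sensAdj f x y := by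
  simp only [sensAdj, Matrix.of_apply]
  split_ifs <;> norm_num

/-- A function approximating `f` controls the sensitivity graph of `f` through commutators. -/
lemma sum_sensAdj_le_commutator {f : (I → Bool) → Bool} {P : (I → Bool) → ℝ}
    (hP : ∀ x, |P x - (if f x then 1 else 0)| ≤ 1 / 3) {a : (I → Bool) → ℝ} (ha : ∀ x, 0 ≤ a x) :
    ∑ x, ∑ y, a x * sensAdj f x y * a y ≤
      6 * ∑ x, ∑ i, ((if f x then 1 else 0) * a x) * (P x - P (flipBit x i)) *
        a (flipBit x i) := by
  set g : (I → Bool) → (I → Bool) → ℝ := fun x y =>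
    if hammingDist x y = 1 then ((if f x then 1 else 0) * a x) * (P x - P y) * a y else 0 with hg
  have h1 : ∑ x, ∑ i, ((if f x then 1 else 0) * a x) * (P x - P (flipBit x i)) *
      a (flipBit x i) = ∑ x, ∑ y, g x y :=
    Finset.sum_congr rfl fun x _ => (sum_hammingDist_eq_one x fun y =>
      ((if f x then 1 else 0) * a x) * (P x - P y) * a y).symm
  have h2 : 6 * ∑ x, ∑ y, g x y = ∑ x, ∑ y, 3 * (g x y + g y x) := by
    simp_rw [← Finset.mul_sum, Finset.sum_add_distrib]
    rw [Finset.sum_comm (f := fun x y => g y x)]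
    ring
  rw [h1, h2]
  refine Finset.sum_le_sum fun x _ => Finset.sum_le_sum fun y _ => ?_
  simp only [hg, sensAdj, Matrix.of_apply, hammingDist_comm y x]
  by_cases hxy : hammingDist x y = 1
  · have hx := abs_le.1 (hP x)
    have hy := abs_le.1 (hP y)
    have hm := mul_nonneg (ha x) (ha y)
    cases hfx : f x <;> cases hfy : f y <;> simp only [hfx, hfy, hxy] at * <;> norm_num at * <;>
      nlinarith
  · simp [hxy]

lemma abs_sum_sensAdj_le {f : (I → Bool) → Bool} {P : (I → Bool) → ℝ} {d : ℕ}
    (hP : ∀ x, |P x - (if f x then 1 else 0)| ≤ 1 / 3)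
    (hd : ∀ S T : Finset I, d < (symmDiff S T).card → ∑ x, walsh S x * P x * walsh T x = 0)
    (v : (I → Bool) → ℝ) :
    |∑ x, ∑ y, v x * sensAdj f x y * v y| ≤ 48 * d * ∑ x, v x ^ 2 := by
  have hM : ∀ x, |P x| ≤ 4 / 3 := by
    intro x
    have := abs_le.1 (hP x)
    rw [abs_le]
    split_ifs at this <;> constructor <;> linarith
  have h1 : |∑ x, ∑ y, v x * sensAdj f x y * v y| ≤ ∑ x, ∑ y, |v x| * sensAdj f x y * |v y| := by
    refine (Finset.abs_sum_le_sum_abs _ _).trans (Finset.sum_le_sum fun x _ => ?_)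
    refine (Finset.abs_sum_le_sum_abs _ _).trans (Finset.sum_le_sum fun y _ => ?_)
    rw [abs_mul, abs_mul, abs_of_nonneg (sensAdj_nonneg f x y)]
  have h2 := sum_sensAdj_le_commutator hP (a := fun x => |v x|) fun x => abs_nonneg _
  have h3 := sum_commutator_le hM hd (fun x => (if f x then 1 else 0) * |v x|) fun x => |v x|
  have h4 : ∑ x, ((if f x then 1 else 0) * |v x|) ^ 2 ≤ ∑ x, v x ^ 2 := by
    refine Finset.sum_le_sum fun x _ => ?_
    split_ifs
    · simp
    · simpa using sq_nonneg (v x)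
  simp only [sq_abs] at h3
  have h5 := mul_le_mul_of_nonneg_left (add_le_add_left h4 (∑ x, v x ^ 2))
    (by positivity : (0 : ℝ) ≤ 3 * (4 / 3) * d)
  linarith

end Walsh

section SpecNorm

variable {J : Type*} [Fintype J] [DecidableEq J]

lemma specNorm_le_of_abs_sum_le {A : Matrix J J ℝ} (hA : ∀ x y, A x y = A y x) {C : ℝ} (hC : 0 ≤ C)
    (h : ∀ v : J → ℝ, |∑ x, ∑ y, v x * A x y * v y| ≤ C * ∑ x, v x ^ 2) : specNorm A ≤ C := by
  have hq : ∀ v w : EuclideanSpace ℝ J,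
      inner ℝ v (Matrix.toEuclideanCLM (𝕜 := ℝ) A w) = ∑ x, ∑ y, v x * A x y * w y := by
    intro v w
    simp only [PiLp.inner_apply, Matrix.ofLp_toEuclideanCLM, Matrix.mulVec, dotProduct,
      RCLike.inner_apply, conj_trivial, Finset.sum_mul]
    exact Finset.sum_congr rfl fun x _ => Finset.sum_congr rfl fun y _ => by ring
  have hn : ∀ v : EuclideanSpace ℝ J, ∑ x, v x ^ 2 = ‖v‖ ^ 2 := fun v => by
    rw [EuclideanSpace.real_norm_sq_eq]
  have hs : (Matrix.toEuclideanCLM (𝕜 := ℝ) A : EuclideanSpace ℝ J →ₗ[ℝ] _).IsSymmetric := by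
    rw [Matrix.coe_toEuclideanCLM_eq_toEuclideanLin, Matrix.isSymmetric_toEuclideanLin_iff]
    exact Matrix.IsHermitian.ext fun x y => hA y x
  rw [specNorm, ContinuousLinearMap.norm_eq_iSup_rayleighQuotient _ hs]
  refine Real.iSup_le (fun v => ?_) hC
  rw [ContinuousLinearMap.rayleighQuotient, abs_div, abs_sq,
    ContinuousLinearMap.reApplyInnerSelf_apply, inner_re_symm, hq, ← hn]
  exact div_le_of_le_mul₀ (Finset.sum_nonneg fun x _ => sq_nonneg _) hC (h v)

end SpecNorm

section AdegB

variable {n : ℕ}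

lemma adegB_set_nonempty (f : (Fin n → Bool) → Bool) :
    {d | ∃ p : MvPolynomial (Fin n) ℝ, p.totalDegree = d ∧
    ∀ x : Fin n → Bool,
      |MvPolynomial.eval (fun i => if x i then (1 : ℝ) else 0) p - (if f x then 1 else 0)|
        ≤ 1/3}.Nonempty := by
  refine ⟨_, ∑ y with f y, ∏ i, (if y i then MvPolynomial.X i else 1 - MvPolynomial.X i), rfl,
    fun x => ?_⟩
  have h : ∀ y : Fin n → Bool, MvPolynomial.eval (fun i => if x i then (1 : ℝ) else 0)
      (∏ i, (if y i then MvPolynomial.X i else 1 - MvPolynomial.X i)) = if x = y then 1 else 0 := by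
    intro y
    rw [map_prod]
    split_ifs with hxy
    · subst hxy
      exact Finset.prod_eq_one fun i _ => by cases h : x i <;> simp [h]
    · obtain ⟨i, hi⟩ := Function.ne_iff.1 hxy
      refine Finset.prod_eq_zero (Finset.mem_univ i) ?_
      cases hx : x i <;> cases hy : y i <;> simp_all
  rw [map_sum]
  simp only [h, Finset.sum_ite_eq, Finset.mem_filter, Finset.mem_univ, true_and]
  norm_num

lemma sum_walsh_mul_eval_mul_walsh_eq_zero (p : MvPolynomial (Fin n) ℝ) {S T : Finset (Fin n)}
    (h : p.totalDegree < (symmDiff S T).card) :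
    ∑ x, walsh S x * MvPolynomial.eval (fun i => if x i then (1 : ℝ) else 0) p * walsh T x = 0 := by
  simp_rw [MvPolynomial.eval_eq, Finset.mul_sum, Finset.sum_mul]
  rw [Finset.sum_comm]
  refine Finset.sum_eq_zero fun m hm => ?_
  have hcard : m.support.card ≤ p.totalDegree := by
    refine le_trans ?_ (MvPolynomial.le_totalDegree hm)
    rw [Finset.card_eq_sum_ones, Finsupp.sum]
    exact Finset.sum_le_sum fun i hi => Nat.one_le_iff_ne_zero.2 (Finsupp.mem_support_iff.1 hi)
  obtain ⟨i, hi, him⟩ := Finset.exists_mem_notMem_of_card_lt_card (hcard.trans_lt h)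
  refine sum_walsh_mul_mul_walsh_eq_zero hi fun x => ?_
  congr 1
  refine Finset.prod_congr rfl fun j hj => ?_
  rw [flipBit_of_ne _ (by rintro rfl; exact him hj)]

end AdegB

/-- There is a universal constant `C > 0` such that for every `n ≥ 1` and
every total Boolean function `f : {0,1}^n → {0,1}`, `λ(f) ≤ C · adeg(f)`. -/
theorem specSens_le_adegB : ∃ C : ℝ, 0 < C ∧
    ∀ n : ℕ, 1 ≤ n → ∀ f : (Fin n → Bool) → Bool,
      specSens f ≤ C * (adegB f : ℝ) := by
  refine ⟨48, by norm_num, fun n _ f => ?_⟩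
  obtain ⟨p, hpd, hp⟩ := Nat.sInf_mem (adegB_set_nonempty f)
  refine specNorm_le_of_abs_sum_le (sensAdj_comm f) (by positivity) fun v => ?_
  refine abs_sum_sensAdj_le hp (fun S T hST => ?_) v
  exact sum_walsh_mul_eval_mul_walsh_eq_zero p (hpd.trans_lt hST)
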